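/- arXiv:0904.2443 — 2 statements merged into one kernel-verified Lean document; each statement's English description precedes it below -/
import Mathlib

section
/- Let f ∈ E_rad be nonzero and φ = φ_f. For each ℓ > 0, the functions e ↦ r₁(φ,e,ℓ) and e ↦ r₂(φ,e,ℓ) are C¹ on (e_{φ,ℓ}, 0), and for every e ∈ (e_{φ,ℓ}, 0) they satisfy 0 < ℓ/(2|f|_{L¹}) ≤ r₁(φ,e,ℓ) < r₂(φ,e,ℓ) ≤ |f|_{L¹}/|e|. -/
noncomputable section

open MeasureTheory Real Filter Set Topology
open scoped ENNReal NNReal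

abbrev E3 : Type := EuclideanSpace ℝ (Fin 3)
abbrev Phase : Type := E3 × E3

/-- Spherical symmetry: invariance under all rotations of `ℝ³` acting jointly on `x` and `v`. -/
def SphSym (f : Phase → ℝ) : Prop :=
  ∀ R : E3 ≃ₗᵢ[ℝ] E3, LinearMap.det (R.toLinearEquiv : E3 →ₗ[ℝ] E3) = 1 →
    ∀ z : Phase, f (R z.1, R z.2) = f z

/-- `|x × v|²`, via the Lagrange identity. -/
def ellOf (z : Phase) : ℝ := ‖z.1‖ ^ 2 * ‖z.2‖ ^ 2 - (inner ℝ z.1 z.2 : ℝ) ^ 2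

/-- Spatial density. -/
def rhoF (f : Phase → ℝ) (x : E3) : ℝ := ∫ v : E3, f (x, v)

/-- Poisson field. -/
def phiF (f : Phase → ℝ) (x : E3) : ℝ := - ∫ y : E3, rhoF f y / (4 * π * ‖x - y‖)

/-- Radial representation of the Poisson field. -/
def phiRad (f : Phase → ℝ) (r : ℝ) : ℝ :=
  phiF f (r • (EuclideanSpace.single (0 : Fin 3) (1:ℝ)))

def mass (f : Phase → ℝ) : ℝ := ∫ z : Phase, f z

def kineticE (f : Phase → ℝ) : ℝ := ∫ z : Phase, ‖z.2‖ ^ 2 * f z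

def gradPhi (f : Phase → ℝ) (x : E3) : E3 := gradient (phiF f) x

def fieldSq (f : Phase → ℝ) : ℝ := ∫ x : E3, ‖gradPhi f x‖ ^ 2

/-- `L²` distance between the force fields of `f` and `g`. -/
def fieldDist (f g : Phase → ℝ) : ℝ :=
  Real.sqrt (∫ x : E3, ‖gradPhi f x - gradPhi g x‖ ^ 2)

/-- The Hamiltonian. -/
def Ham (f : Phase → ℝ) : ℝ := kineticE f / 2 - fieldSq f / 2

/-- The norm of the energy space. -/
def eNormE (f : Phase → ℝ) : ℝ≥0∞ :=
  eLpNorm f 1 volume + eLpNorm f ⊤ volume +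
    ∫⁻ z : Phase, (‖z.2‖₊ : ℝ≥0∞) ^ 2 * (‖f z‖₊ : ℝ≥0∞)

def memE (f : Phase → ℝ) : Prop := Measurable f ∧ (∀ z, 0 ≤ f z) ∧ eNormE f < ⊤

def memErad (f : Phase → ℝ) : Prop := memE f ∧ SphSym f

/-- Density of the measure `ν_ℓ`. -/
def nuDens (ℓ : ℝ) (p : ℝ × ℝ) : ℝ≥0∞ :=
  if 0 < p.1 ∧ ℓ < p.1 ^ 2 * p.2 ^ 2 then
    ENNReal.ofReal (4 * π ^ 2 * p.1 * |p.2| / Real.sqrt (p.1 ^ 2 * p.2 ^ 2 - ℓ))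
  else 0

def nuMeas (ℓ : ℝ) : Measure (ℝ × ℝ) := volume.withDensity (nuDens ℓ)

/-- Representative phase point with `|x| = r`, `|v| = |u|`, `|x×v|² = ℓ` and
`x·v = sign u · √(r²u²-ℓ)`. -/
def radPoint (r u ℓ : ℝ) : Phase :=
  (r • (EuclideanSpace.single (0 : Fin 3) (1:ℝ)),
   (Real.sign u * Real.sqrt (r ^ 2 * u ^ 2 - ℓ) / r) • (EuclideanSpace.single (0 : Fin 3) (1:ℝ))
     + (Real.sqrt ℓ / r) • (EuclideanSpace.single (1 : Fin 3) (1:ℝ)))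

/-- Distribution function of `f` at kinetic momentum `ℓ`. -/
def muDist (f : Phase → ℝ) (s ℓ : ℝ) : ℝ≥0∞ :=
  nuMeas ℓ {p : ℝ × ℝ | s < f (radPoint p.1 p.2 ℓ)}

/-- `g ∈ Eq(f)` : `g` is nonnegative, spherically symmetric and equimeasurable to `f`
at (almost) every kinetic momentum `ℓ`. -/
def EqMeas (f g : Phase → ℝ) : Prop :=
  (∀ z, 0 ≤ g z) ∧ SphSym g ∧
    ∀ s : ℝ, 0 < s →
      ∀ᵐ ℓ ∂(volume.restrict (Ioi (0:ℝ))), muDist g s ℓ = muDist f s ℓ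

/-- Schwarz symmetrization of `f` at fixed `ℓ`. -/
def schwarz (f : Phase → ℝ) (t ℓ : ℝ) : ℝ :=
  if ENNReal.ofReal t < muDist f 0 ℓ then
    sSup {s : ℝ | 0 ≤ s ∧ ENNReal.ofReal t < muDist f s ℓ}
  else 0

/-- Effective potential. -/
def psiPot (φ : ℝ → ℝ) (ℓ r : ℝ) : ℝ := φ r + ℓ / (2 * r ^ 2)

def eMinPot (φ : ℝ → ℝ) (ℓ : ℝ) : ℝ := sInf (psiPot φ ℓ '' Ioi 0)

def r1Pot (φ : ℝ → ℝ) (e ℓ : ℝ) : ℝ := sInf {r : ℝ | 0 < r ∧ psiPot φ ℓ r < e}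

def r2Pot (φ : ℝ → ℝ) (e ℓ : ℝ) : ℝ := sSup {r : ℝ | 0 < r ∧ psiPot φ ℓ r < e}

/-- The Jacobian `a_φ(e, ℓ)` (meaningful for `e < 0`). -/
def aPot (φ : ℝ → ℝ) (e ℓ : ℝ) : ℝ :=
  8 * π ^ 2 * Real.sqrt 2 * ∫ r in Ioi (0:ℝ), Real.sqrt (max (e - psiPot φ ℓ r) 0)

/-- Inverse of the bijection `e ↦ a_φ(e,ℓ)` from `(e_{φ,ℓ},0)` onto `(0,∞)`. -/
def aPotInv (φ : ℝ → ℝ) (s ℓ : ℝ) : ℝ :=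
  sSup {e : ℝ | eMinPot φ ℓ < e ∧ e < 0 ∧ aPot φ e ℓ < s}

/-- Microscopic energy w.r.t. the Poisson field of `g`. -/
def microE (g : Phase → ℝ) (z : Phase) : ℝ := ‖z.2‖ ^ 2 / 2 + phiF g z.1

/-- Rearrangement of `f` with respect to the microscopic energy of the field of `g`. -/
def rearr (f g : Phase → ℝ) (z : Phase) : ℝ :=
  if microE g z < 0 then
    schwarz f (aPot (phiRad g) (microE g z) (ellOf z)) (ellOf z)
  else 0

/-- Assumption (A). -/
structure AssumptionA (Q : Phase → ℝ) (F : ℝ → ℝ → ℝ) (e₀ : ℝ) : Prop where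
  contQ : Continuous Q
  nonneg : ∀ z, 0 ≤ Q z
  nonzero : Q ≠ 0
  cpt : HasCompactSupport Q
  sph : SphSym Q
  eqF : ∀ z : Phase, Q z = F (microE Q z) (ellOf z)
  Fnonneg : ∀ e ℓ, 0 ≤ ℓ → 0 ≤ F e ℓ
  Fcont : ContinuousOn (fun p : ℝ × ℝ => F p.1 p.2) {p : ℝ × ℝ | 0 ≤ p.2}
  e₀neg : e₀ < 0
  Fsupp : ∀ e ℓ, 0 ≤ ℓ → 0 < F e ℓ → e < e₀
  FC1 : ContDiffOn ℝ 1 (fun p : ℝ × ℝ => F p.1 p.2) {p : ℝ × ℝ | 0 ≤ p.2 ∧ 0 < F p.1 p.2}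
  FeNeg : ∀ e ℓ, 0 ≤ ℓ → 0 < F e ℓ → deriv (fun e' => F e' ℓ) e < 0

/-- The reduced functional `J_{f^*}(φ_g) = H(f^{*φ_g}) + ½|∇φ_g − ∇φ_{f^{*φ_g}}|²`. -/
def Jred (f g : Phase → ℝ) : ℝ :=
  Ham (rearr f g) + (∫ x : E3, ‖gradPhi g x - gradPhi (rearr f g) x‖ ^ 2) / 2

def distL1 (f g : Phase → ℝ) : ℝ := ∫ z : Phase, |f z - g z|

def distL1v (f g : Phase → ℝ) : ℝ := ∫ z : Phase, ‖z.2‖ ^ 2 * |f z - g z|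


lemma local_inv_aux (ψ h g : ℝ → ℝ) (U V : Set ℝ) (hU : IsOpen U) (hV : IsOpen V)
    (hψ : ∀ r ∈ U, HasDerivAt ψ (h r) r) (hh : ContinuousOn h U) (h0 : ∀ r ∈ U, h r ≠ 0)
    (hinj : InjOn ψ U) (hg : ∀ e ∈ V, g e ∈ U ∧ ψ (g e) = e) : ContDiffOn ℝ 1 g V := by
  have hC : ContDiffOn ℝ 1 ψ U := by
    have : (1 : WithTop ℕ∞) = 0 + 1 := by simp
    rw [this, contDiffOn_succ_iff_deriv_of_isOpen hU]
    refine ⟨fun x hx => (hψ x hx).differentiableAt.differentiableWithinAt, by simp, ?_⟩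
    rw [contDiffOn_zero]
    exact hh.congr (fun x hx => (hψ x hx).deriv)
  intro e he
  apply ContDiffAt.contDiffWithinAt
  obtain ⟨hgU, hge⟩ := hg e he
  have hCa : ContDiffAt ℝ 1 ψ (g e) := hC.contDiffAt (hU.mem_nhds hgU)
  have hd : HasFDerivAt ψ ((ContinuousLinearEquiv.unitsEquivAut ℝ (Units.mk0 (h (g e)) (h0 _ hgU)) : ℝ ≃L[ℝ] ℝ) : ℝ →L[ℝ] ℝ) (g e) :=
    (hψ _ hgU).hasFDerivAt_equiv (h0 _ hgU)
  have h1 : (1 : WithTop ℕ∞) ≠ 0 := by simp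
  have hL := hCa.to_localInverse hd h1
  have hLv := hCa.localInverse_apply_image hd h1
  rw [hge] at hL hLv
  refine hL.congr_of_eventuallyEq ?_
  have hr := (hCa.hasStrictFDerivAt' hd h1).eventually_right_inverse
  rw [hge] at hr
  have hc : ∀ᶠ y in 𝓝 e, hCa.localInverse hd h1 y ∈ U :=
    hL.continuousAt.eventually_mem (by rw [hLv]; exact hU.mem_nhds hgU)
  filter_upwards [hr, hc, hV.mem_nhds he] with y h1 h2 h3
  exact hinj (hg y h3).1 h2 ((hg y h3).2.trans h1.symm)

lemma abstract_part (φ h : ℝ → ℝ) (ℓ a M r0 : ℝ) (ha : 0 < a) (hr0 : 0 < r0)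
    (hψ : ∀ r, 0 < r → HasDerivAt (psiPot φ ℓ) (h r) r) (hh : ContinuousOn h (Ioi 0))
    (hneg : ∀ r, 0 < r → r < r0 → h r < 0) (hpos : ∀ r, r0 < r → 0 < h r)
    (hlow : ∀ r, 0 < r → psiPot φ ℓ r < 0 → a ≤ r)
    (hup : ∀ r e, 0 < r → e < 0 → psiPot φ ℓ r < e → r ≤ M / |e|) :
    ContDiffOn ℝ 1 (fun e => r1Pot φ e ℓ) (Ioo (eMinPot φ ℓ) 0) ∧
    ContDiffOn ℝ 1 (fun e => r2Pot φ e ℓ) (Ioo (eMinPot φ ℓ) 0) ∧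
    ∀ e ∈ Ioo (eMinPot φ ℓ) 0,
      a ≤ r1Pot φ e ℓ ∧ r1Pot φ e ℓ < r2Pot φ e ℓ ∧ r2Pot φ e ℓ ≤ M / |e| := by
  set ψ := psiPot φ ℓ with hψdef
  have hcont : ∀ r, 0 < r → ContinuousAt ψ r := fun r hr => (hψ r hr).continuousAt
  have hanti : StrictAntiOn ψ (Ioc 0 r0) := by
    apply strictAntiOn_of_deriv_neg (convex_Ioc _ _)
    · intro x hx; exact (hcont x hx.1).continuousWithinAt
    · intro x hx
      rw [interior_Ioc] at hx
      rw [(hψ x hx.1).deriv]; exact hneg x hx.1 hx.2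
  have hmono : StrictMonoOn ψ (Ici r0) := by
    apply strictMonoOn_of_deriv_pos (convex_Ici _)
    · intro x hx; exact (hcont x (hr0.trans_le hx)).continuousWithinAt
    · intro x hx
      rw [interior_Ici] at hx
      rw [(hψ x (hr0.trans hx)).deriv]; exact hpos x hx
  have hmin : eMinPot φ ℓ = ψ r0 := by
    apply IsLeast.csInf_eq
    refine ⟨⟨r0, hr0, rfl⟩, ?_⟩
    rintro _ ⟨r, hr, rfl⟩
    rcases le_total r r0 with h1 | h1
    · exact hanti.antitoneOn ⟨hr, h1⟩ ⟨hr0, le_rfl⟩ h1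
    · exact hmono.monotoneOn (mem_Ici.2 le_rfl) h1 h1
  rw [hmin]
  have key : ∀ e ∈ Ioo (ψ r0) 0, (r1Pot φ e ℓ ∈ Ioo 0 r0 ∧ ψ (r1Pot φ e ℓ) = e) ∧
      (r2Pot φ e ℓ ∈ Ioi r0 ∧ ψ (r2Pot φ e ℓ) = e) ∧
      a ≤ r1Pot φ e ℓ ∧ r2Pot φ e ℓ ≤ M / |e| := by
    rintro e ⟨he1, he2⟩
    have hS : ∀ r ∈ {r : ℝ | 0 < r ∧ psiPot φ ℓ r < e}, a ≤ r := fun r hr => hlow r hr.1 (hr.2.trans he2)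
    have hS2 : ∀ r ∈ {r : ℝ | 0 < r ∧ psiPot φ ℓ r < e}, r ≤ M / |e| := fun r hr => hup r e hr.1 he2 hr.2
    have hr0S : r0 ∈ {r : ℝ | 0 < r ∧ psiPot φ ℓ r < e} := ⟨hr0, he1⟩
    have hopen : ∀ x, 0 < x → ψ x < e → ∀ᶠ y in 𝓝 x, y ∈ {r : ℝ | 0 < r ∧ psiPot φ ℓ r < e} := by
      intro x hx hxe
      filter_upwards [lt_mem_nhds hx, (hcont x hx).eventually_lt_const hxe] with y h1 h2
      exact ⟨h1, h2⟩
    have hclos : ∀ x, 0 < x → x ∈ closure {r : ℝ | 0 < r ∧ psiPot φ ℓ r < e} → ψ x ≤ e := by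
      intro x hx hxc
      by_contra! hlt
      have := (hcont x hx).eventually_const_lt hlt
      obtain ⟨y, h1, h2⟩ := mem_closure_iff_nhds.1 hxc _ this
      exact lt_asymm h1 h2.2
    have bb : BddBelow {r : ℝ | 0 < r ∧ psiPot φ ℓ r < e} := ⟨a, hS⟩
    have ba : BddAbove {r : ℝ | 0 < r ∧ psiPot φ ℓ r < e} := ⟨_, hS2⟩
    have ha1 : a ≤ r1Pot φ e ℓ := le_csInf ⟨r0, hr0S⟩ hS
    have hb1 : r2Pot φ e ℓ ≤ M / |e| := csSup_le ⟨r0, hr0S⟩ hS2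
    have h1le : r1Pot φ e ℓ ≤ r0 := csInf_le bb hr0S
    have h2le : r0 ≤ r2Pot φ e ℓ := le_csSup ba hr0S
    have hp1 : 0 < r1Pot φ e ℓ := ha.trans_le ha1
    have hp2 : 0 < r2Pot φ e ℓ := hr0.trans_le h2le
    have e1 : ψ (r1Pot φ e ℓ) = e := by
      apply le_antisymm (hclos _ hp1 (csInf_mem_closure ⟨r0, hr0S⟩ bb))
      by_contra! hlt
      have := hopen _ hp1 hlt
      obtain ⟨y, hy, hy2⟩ := ((this.filter_mono nhdsWithin_le_nhds).and
        (self_mem_nhdsWithin : Iio (r1Pot φ e ℓ) ∈ 𝓝[<] (r1Pot φ e ℓ))).exists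
      exact absurd (csInf_le bb hy) (not_le.2 hy2)
    have e2 : ψ (r2Pot φ e ℓ) = e := by
      apply le_antisymm (hclos _ hp2 (csSup_mem_closure ⟨r0, hr0S⟩ ba))
      by_contra! hlt
      have := hopen _ hp2 hlt
      obtain ⟨y, hy, hy2⟩ := ((this.filter_mono nhdsWithin_le_nhds).and
        (self_mem_nhdsWithin : Ioi (r2Pot φ e ℓ) ∈ 𝓝[>] (r2Pot φ e ℓ))).exists
      exact absurd (le_csSup ba hy) (not_le.2 hy2)
    refine ⟨⟨⟨hp1, lt_of_le_of_ne h1le ?_⟩, e1⟩, ⟨lt_of_le_of_ne h2le ?_, e2⟩, ha1, hb1⟩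
    · intro hc; rw [hc] at e1; exact he1.ne e1
    · intro hc; rw [← hc] at e2; exact he1.ne e2
  refine ⟨?_, ?_, ?_⟩
  · refine local_inv_aux ψ h _ (Ioo 0 r0) _ isOpen_Ioo isOpen_Ioo (fun r hr => hψ r hr.1)
      (hh.mono fun r hr => hr.1) (fun r hr => (hneg r hr.1 hr.2).ne)
      (hanti.injOn.mono Ioo_subset_Ioc_self) (fun e he => (key e he).1)
  · refine local_inv_aux ψ h _ (Ioi r0) _ isOpen_Ioi isOpen_Ioo (fun r hr => hψ r (hr0.trans hr))
      (hh.mono fun r hr => hr0.trans hr) (fun r hr => (hpos r hr).ne')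
      (hmono.injOn.mono Ioi_subset_Ici_self) (fun e he => (key e he).2.1)
  · intro e he
    obtain ⟨⟨h1, -⟩, ⟨h2, -⟩, h3, h4⟩ := key e he
    exact ⟨h3, h1.2.trans h2, h4⟩

lemma lintegral_E3 (K : ℝ → ℝ → ℝ≥0∞) (hK : Measurable (fun p : ℝ × ℝ => K p.1 p.2)) :
    ∫⁻ y : E3, K ‖y‖ (y 0) = ∫⁻ s in Ioi (0:ℝ), ∫⁻ θ in Ioo 0 π,
      ENNReal.ofReal (2 * π) * ENNReal.ofReal s * ENNReal.ofReal (s * sin θ) * K s (s * cos θ) := by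
  have hn : ∀ y : E3, ‖y‖ = √(y 0 ^ 2 + (y 1 ^ 2 + y 2 ^ 2)) := by
    intro y
    rw [EuclideanSpace.norm_eq, Fin.sum_univ_three]; simp [add_assoc]
  set e1 := MeasurableEquiv.piFinSuccAbove (fun _ : Fin 3 => ℝ) 0
  set H : ℝ → ℝ × ℝ → ℝ≥0∞ := fun z q => K (√(z ^ 2 + (q.1 ^ 2 + q.2 ^ 2))) z with hH
  have hHm : Measurable (fun p : ℝ × (ℝ × ℝ) => H p.1 p.2) :=
    hK.comp (g := fun p : ℝ × ℝ => K p.1 p.2)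
      (f := fun p : ℝ × (ℝ × ℝ) => (√(p.1 ^ 2 + (p.2.1 ^ 2 + p.2.2 ^ 2)), p.1)) (by fun_prop)
  have s1 : ∫⁻ y : E3, K ‖y‖ (y 0) = ∫⁻ z : ℝ, ∫⁻ q : ℝ × ℝ, H z q := by
    have mp : MeasurePreserving (fun y : E3 => ((y 0, (y 1, y 2)) : ℝ × (ℝ × ℝ))) volume volume := by
      have m1 := PiLp.volume_preserving_ofLp (Fin 3)
      have m2 := volume_preserving_piFinSuccAbove (fun _ : Fin 3 => ℝ) 0
      have m3 := (MeasurePreserving.id (volume : Measure ℝ)).prod (volume_preserving_finTwoArrow ℝ)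
      exact (m3.comp m2).comp m1
    have := mp.lintegral_comp (f := fun p => H p.1 p.2) hHm
    rw [Measure.volume_eq_prod, lintegral_prod _ hHm.aemeasurable] at this
    rw [← this]
    apply lintegral_congr; intro y
    simp only [hH, ← hn]
  have s2 : ∀ z, ∫⁻ q : ℝ × ℝ, H z q =
      ∫⁻ t in Ioi (0:ℝ), ENNReal.ofReal (2 * π) * ENNReal.ofReal t * K (√(z ^ 2 + t ^ 2)) z := by
    intro z
    rw [← lintegral_comp_polarCoord_symm, polarCoord_target, Measure.volume_eq_prod,
      ← Measure.prod_restrict, lintegral_prod]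
    · apply lintegral_congr; intro t
      have : ∀ α : ℝ, ENNReal.ofReal t • H z (polarCoord.symm (t, α)) =
          ENNReal.ofReal t * K (√(z ^ 2 + t ^ 2)) z := by
        intro α
        simp only [hH, polarCoord_symm_apply, smul_eq_mul]
        congr 4
        linear_combination t ^ 2 * sin_sq_add_cos_sq α
      simp only [this]
      rw [lintegral_const, Measure.restrict_apply MeasurableSet.univ, univ_inter, Real.volume_Ioo]
      rw [mul_comm, ← mul_assoc]; congr 3; ring
    · apply Measurable.aemeasurable
      have : Measurable (fun p : ℝ × ℝ => K (√(z ^ 2 + ((p.1 * cos p.2) ^ 2 + (p.1 * sin p.2) ^ 2))) z) :=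
        hK.comp (g := fun p : ℝ × ℝ => K p.1 p.2)
         (f := fun p : ℝ × ℝ => (√(z ^ 2 + ((p.1 * cos p.2) ^ 2 + (p.1 * sin p.2) ^ 2)), z)) (by fun_prop)
      simp only [hH, polarCoord_symm_apply, smul_eq_mul]
      exact (by fun_prop : Measurable fun p : ℝ × ℝ => ENNReal.ofReal p.1).mul this
  set G : ℝ × ℝ → ℝ≥0∞ := fun p =>
    (Ioi (0:ℝ)).indicator (fun t => ENNReal.ofReal (2 * π) * ENNReal.ofReal t * K (√(p.1 ^ 2 + t ^ 2)) p.1) p.2 with hG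
  have hGm : Measurable G := by
    have h1 : Measurable (fun p : ℝ × ℝ => K (√(p.1 ^ 2 + p.2 ^ 2)) p.1) :=
        hK.comp (g := fun p : ℝ × ℝ => K p.1 p.2)
         (f := fun p : ℝ × ℝ => (√(p.1 ^ 2 + p.2 ^ 2), p.1)) (by fun_prop)
    have h2 : Measurable (fun p : ℝ × ℝ => ENNReal.ofReal (2 * π) * ENNReal.ofReal p.2 * K (√(p.1 ^ 2 + p.2 ^ 2)) p.1) :=
      Measurable.mul (by fun_prop) h1
    exact h2.indicator (measurableSet_Ioi.preimage measurable_snd)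
  have s3 : ∫⁻ z : ℝ, ∫⁻ q : ℝ × ℝ, H z q = ∫⁻ p : ℝ × ℝ, G p := by
    rw [Measure.volume_eq_prod, lintegral_prod _ hGm.aemeasurable]
    apply lintegral_congr; intro z
    rw [← Measure.volume_eq_prod, s2, ← lintegral_indicator measurableSet_Ioi]
  rw [s1, s3, ← lintegral_comp_polarCoord_symm, polarCoord_target, Measure.volume_eq_prod,
      ← Measure.prod_restrict, lintegral_prod]
  · apply setLIntegral_congr_fun measurableSet_Ioi
    intro s hs
    have hs : 0 < s := hs
    simp only
    have hsub : Ioo 0 π ⊆ Ioo (-π) π := Ioo_subset_Ioo_left (by linarith [pi_pos])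
    rw [← lintegral_indicator measurableSet_Ioo, ← lintegral_indicator measurableSet_Ioo]
    apply lintegral_congr; intro θ
    by_cases hθ : θ ∈ Ioo 0 π
    · rw [indicator_of_mem hθ, indicator_of_mem (hsub hθ)]
      have hsin := sin_pos_of_mem_Ioo hθ
      simp only [hG, polarCoord_symm_apply, smul_eq_mul]
      rw [indicator_of_mem (show s * sin θ ∈ Ioi 0 from mul_pos hs hsin)]
      have : √((s * cos θ) ^ 2 + (s * sin θ) ^ 2) = s := by
        rw [show (s * cos θ) ^ 2 + (s * sin θ) ^ 2 = s ^ 2 by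
          linear_combination s ^ 2 * sin_sq_add_cos_sq θ, sqrt_sq hs.le]
      rw [this]; ring
    · rw [indicator_of_notMem hθ]
      by_cases hθ2 : θ ∈ Ioo (-π) π
      · rw [indicator_of_mem hθ2]
        have hle : θ ≤ 0 := by
          by_contra! hc; exact hθ ⟨hc, hθ2.2⟩
        have hsin := sin_nonpos_of_nonpos_of_neg_pi_le hle hθ2.1.le
        simp only [hG, polarCoord_symm_apply, smul_eq_mul]
        rw [indicator_of_notMem, mul_zero]
        simp only [mem_Ioi, not_lt]
        exact mul_nonpos_of_nonneg_of_nonpos hs.le hsin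
      · rw [indicator_of_notMem hθ2]
  · apply Measurable.aemeasurable
    simp only [polarCoord_symm_apply, smul_eq_mul]
    refine Measurable.mul (by fun_prop) (hGm.comp (by fun_prop))

lemma theta_integral (r s : ℝ) (hr : 0 < r) (hs : 0 < s) (hrs : r ≠ s) :
    ∫⁻ θ in Ioo 0 π, ENNReal.ofReal (sin θ / √(r ^ 2 - 2 * r * (s * cos θ) + s ^ 2)) =
    ∫⁻ θ in Ioo 0 π, ENNReal.ofReal (sin θ / max r s) := by
  have hpos : ∀ θ, 0 < r ^ 2 - 2 * r * (s * cos θ) + s ^ 2 := by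
    intro θ
    have h1 := cos_le_one θ
    have h2 : 0 < (r - s) ^ 2 := by positivity [sub_ne_zero.2 hrs]
    nlinarith [mul_pos hr hs]
  have c1 : Continuous fun θ => sin θ / √(r ^ 2 - 2 * r * (s * cos θ) + s ^ 2) :=
    Continuous.div (by fun_prop) (by fun_prop) (fun θ => (sqrt_pos.2 (hpos θ)).ne')
  have c2 : Continuous fun θ => sin θ / max r s := by fun_prop
  have conv : ∀ g : ℝ → ℝ, Continuous g → (∀ θ ∈ Ioo 0 π, 0 ≤ g θ) →
      ∫⁻ θ in Ioo 0 π, ENNReal.ofReal (g θ) = ENNReal.ofReal (∫ θ in (0:ℝ)..π, g θ) := by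
    intro g hg hg0
    rw [intervalIntegral.integral_of_le pi_pos.le, integral_Ioc_eq_integral_Ioo,
      ofReal_integral_eq_lintegral_ofReal]
    · exact (hg.integrableOn_Icc (a := 0) (b := π)).mono_set Ioo_subset_Icc_self
    · exact (ae_restrict_iff' measurableSet_Ioo).2 (ae_of_all _ hg0)
  have hm : 0 < max r s := lt_max_of_lt_left hr
  rw [conv _ c1, conv _ c2]
  · congr 1
    have d1 : ∀ θ ∈ uIcc 0 π, HasDerivAt (fun θ => √(r ^ 2 - 2 * r * (s * cos θ) + s ^ 2) / (r * s))
        (sin θ / √(r ^ 2 - 2 * r * (s * cos θ) + s ^ 2)) θ := by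
      intro θ _
      have hh : HasDerivAt (fun θ => r ^ 2 - 2 * r * (s * cos θ) + s ^ 2) (2 * r * (s * sin θ)) θ := by
        have := ((((hasDerivAt_cos θ).const_mul s).const_mul (2 * r)).const_sub (r ^ 2)).add_const (s ^ 2)
        refine this.congr_deriv ?_; ring
      have := (hh.sqrt (hpos θ).ne').div_const (r * s)
      refine this.congr_deriv ?_
      have := (sqrt_pos.2 (hpos θ)).ne'
      field_simp
    rw [intervalIntegral.integral_eq_sub_of_hasDerivAt d1 (c1.intervalIntegrable _ _),
      intervalIntegral.integral_div, integral_sin]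
    simp only [cos_pi, cos_zero]
    rw [show r ^ 2 - 2 * r * (s * -1) + s ^ 2 = (r + s) ^ 2 by ring,
      show r ^ 2 - 2 * r * (s * 1) + s ^ 2 = (r - s) ^ 2 by ring, sqrt_sq (by positivity), sqrt_sq_eq_abs]
    rcases le_total r s with h | h
    · rw [max_eq_right h, abs_of_nonpos (by linarith)]; field_simp; ring
    · rw [max_eq_left h, abs_of_nonneg (by linarith)]; field_simp; ring
  · intro θ hθ; exact div_nonneg (sin_pos_of_mem_Ioo hθ).le hm.le
  · intro θ hθ; exact div_nonneg (sin_pos_of_mem_Ioo hθ).le (sqrt_nonneg _)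

lemma newton (P : ℝ → ℝ) (hP : Measurable P) (hP0 : ∀ s, 0 ≤ P s) (r : ℝ) (hr : 0 < r) :
    ∫ y : E3, P ‖y‖ / (4 * π * ‖r • (EuclideanSpace.single (0 : Fin 3) (1:ℝ)) - y‖) =
    ∫ y : E3, P ‖y‖ / (4 * π * max r ‖y‖) := by
  have hnorm : ∀ y : E3, ‖r • (EuclideanSpace.single (0 : Fin 3) (1:ℝ)) - y‖ =
      √(r ^ 2 - 2 * r * y 0 + ‖y‖ ^ 2) := by
    intro y
    rw [EuclideanSpace.norm_eq, EuclideanSpace.norm_sq_eq]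
    congr 1
    simp [Fin.sum_univ_three]
    ring
  have hpi := pi_pos
  simp only [hnorm]
  rw [integral_eq_lintegral_of_nonneg_ae, integral_eq_lintegral_of_nonneg_ae]
  rotate_left
  · exact ae_of_all _ fun y => div_nonneg (hP0 _) (by positivity)
  · exact Measurable.aestronglyMeasurable (by fun_prop)
  · exact ae_of_all _ fun y => div_nonneg (hP0 _) (by positivity)
  · refine Measurable.aestronglyMeasurable (by fun_prop)
  congr 1
  rw [lintegral_E3 (fun s z => ENNReal.ofReal (P s / (4 * π * √(r ^ 2 - 2 * r * z + s ^ 2)))) (by fun_prop),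
    lintegral_E3 (fun s z => ENNReal.ofReal (P s / (4 * π * max r s))) (by fun_prop)]
  apply lintegral_congr_ae
  have hne : ∀ᵐ s ∂(volume.restrict (Ioi (0:ℝ))), s ≠ r :=
    ae_restrict_of_ae (Measure.ae_ne volume r)
  filter_upwards [hne, ae_restrict_mem measurableSet_Ioi] with s hs1 hs2
  have hs2 : 0 < s := hs2
  have key : ∀ q : ℝ → ℝ, Measurable q → (∀ θ, 0 ≤ q θ) → ∫⁻ θ in Ioo 0 π, ENNReal.ofReal (2 * π) * ENNReal.ofReal s * ENNReal.ofReal (s * sin θ) *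
       ENNReal.ofReal (P s / (4 * π * q θ)) = ENNReal.ofReal (s ^ 2 * P s / 2) * ∫⁻ θ in Ioo 0 π, ENNReal.ofReal (sin θ / q θ) := by
    intro q hq hq0
    rw [← lintegral_const_mul _ (by fun_prop)]
    apply setLIntegral_congr_fun measurableSet_Ioo
    intro θ hθ
    have hsin := (sin_pos_of_mem_Ioo hθ).le
    have := hP0 s
    simp only
    rw [← ENNReal.ofReal_mul (by positivity), ← ENNReal.ofReal_mul (by positivity), ← ENNReal.ofReal_mul (by positivity),
      ← ENNReal.ofReal_mul (by positivity)]
    congr 1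
    rw [div_mul_eq_div_div]
    field_simp
    ring
  rw [key (fun θ => √(r ^ 2 - 2 * r * (s * cos θ) + s ^ 2)) (by fun_prop) (fun _ => sqrt_nonneg _),
    key (fun θ => max r s) (by fun_prop) (fun _ => by positivity), theta_integral r s hr hs2 hs1.symm]

lemma rot_exists (x y : E3) (hxy : ‖x‖ = ‖y‖) : ∃ R : E3 ≃ₗᵢ[ℝ] E3,
    LinearMap.det (R.toLinearEquiv : E3 →ₗ[ℝ] E3) = 1 ∧ R x = y := by
  have hdet : ∀ w : E3, w ≠ 0 →
      LinearMap.det ((ℝ ∙ w).reflection.toLinearEquiv : E3 →ₗ[ℝ] E3) = 1 := by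
    intro w hw
    have h1 := Submodule.det_reflection (ℝ ∙ w)
    have : Fact (Module.finrank ℝ E3 = 2 + 1) := ⟨by simp⟩
    rw [Submodule.finrank_orthogonal_span_singleton (n := 2) hw] at h1
    simpa using h1
  by_cases h : x + y = 0
  · have hy : y = -x := by rw [eq_neg_iff_add_eq_zero, add_comm]; exact h
    obtain ⟨w, hw0, hw⟩ : ∃ w : E3, w ≠ 0 ∧ inner ℝ w x = 0 := by
      by_cases hx : x = 0
      · refine ⟨EuclideanSpace.single 0 1, ?_, by simp [hx]⟩
        intro hc
        have := congrArg norm hc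
        simp at this
      · have : Fact (Module.finrank ℝ E3 = 2 + 1) := ⟨by simp⟩
        have hfr := Submodule.finrank_orthogonal_span_singleton (𝕜 := ℝ) (n := 2) hx
        have : (ℝ ∙ x)ᗮ ≠ ⊥ := by
          intro hc; rw [hc] at hfr; simp at hfr
        obtain ⟨w, hw, hw0⟩ := Submodule.exists_mem_ne_zero_of_ne_bot this
        refine ⟨w, hw0, ?_⟩
        rw [real_inner_comm]
        exact Submodule.mem_orthogonal_singleton_iff_inner_right.1 hw
    refine ⟨(ℝ ∙ w).reflection, hdet w hw0, ?_⟩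
    rw [hy]
    apply Submodule.reflection_mem_subspace_orthogonalComplement_eq_neg
    exact Submodule.mem_orthogonal_singleton_iff_inner_right.2 hw
  · refine ⟨(ℝ ∙ (x + y)).reflection, hdet _ h, ?_⟩
    have e1 : x = (1/2 : ℝ) • (x + y) + (1/2 : ℝ) • (x - y) := by module
    have m1 : (1/2 : ℝ) • (x + y) ∈ (ℝ ∙ (x + y)) :=
      Submodule.smul_mem _ _ (Submodule.mem_span_singleton_self _)
    have m2 : (1/2 : ℝ) • (x - y) ∈ (ℝ ∙ (x + y))ᗮ := by
      apply Submodule.smul_mem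
      rw [Submodule.mem_orthogonal_singleton_iff_inner_right]
      exact (real_inner_add_sub_eq_zero_iff x y).2 hxy
    have e2 := congrArg (ℝ ∙ (x + y)).reflection e1
    rw [e2, map_add, Submodule.reflection_mem_subspace_eq_self m1,
      Submodule.reflection_mem_subspace_orthogonalComplement_eq_neg m2]
    module

lemma rho_radial (f : Phase → ℝ) (hf : SphSym f) (y : E3) :
    rhoF f y = rhoF f (‖y‖ • (EuclideanSpace.single (0 : Fin 3) (1:ℝ))) := by
  obtain ⟨R, hR, hRy⟩ := rot_exists y (‖y‖ • (EuclideanSpace.single (0 : Fin 3) (1:ℝ)))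
    (by simp [norm_smul])
  rw [← hRy]
  unfold rhoF
  rw [← R.measurePreserving.integral_comp R.toHomeomorph.measurableEmbedding (fun v => f (R y, v))]
  congr 1; ext v
  exact (hf R hR (y, v)).symm

lemma ae_norm_ne (r : ℝ) : ∀ᵐ y : E3, ‖y‖ ≠ r := by
  have := Measure.addHaar_sphere (volume : Measure E3) 0 r
  rw [measure_eq_zero_iff_ae_notMem] at this
  filter_upwards [this] with y hy
  simpa using hy

lemma pot_deriv (ρ : E3 → ℝ) (hρ : Integrable ρ) (r : ℝ) (hr : 0 < r) :
    HasDerivAt (fun r => ∫ y : E3, ρ y / (4 * π * max r ‖y‖))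
      (-(∫ y in Metric.ball (0:E3) r, ρ y) / (4 * π * r ^ 2)) r := by
  have hpi := pi_pos
  have hF' : -(∫ y in Metric.ball (0:E3) r, ρ y) / (4 * π * r ^ 2) =
      ∫ y, (Metric.ball (0:E3) r).indicator (fun y => -ρ y / (4 * π * r ^ 2)) y := by
    rw [integral_indicator Metric.isOpen_ball.measurableSet, integral_div, integral_neg]
  have hmeas : ∀ x, AEStronglyMeasurable (fun y : E3 => ρ y / (4 * π * max x ‖y‖)) volume := by
    intro x
    have : Measurable (fun y : E3 => 4 * π * max x ‖y‖) := by fun_prop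
    simp only [div_eq_mul_inv]
    exact hρ.1.mul this.inv.aestronglyMeasurable
  rw [hF']
  refine (hasDerivAt_integral_of_dominated_loc_of_lip (bound := fun y => |ρ y| * (1 / (π * r ^ 2)))
    (F := fun r y => ρ y / (4 * π * max r ‖y‖))
    (Metric.ball_mem_nhds r (half_pos hr)) (Eventually.of_forall hmeas) ?_ ?_ ?_ ?_ ?_).2
  · refine Integrable.mono' (hρ.norm.div_const (4 * π * r)) (hmeas r) (ae_of_all _ fun y => ?_)
    have h1 : 0 < max r ‖y‖ := lt_max_of_lt_left hr
    rw [norm_div, Real.norm_of_nonneg (by positivity : 0 ≤ 4 * π * max r ‖y‖)]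
    gcongr
    exact le_max_left _ _
  · exact ((hρ.neg.div_const _).indicator Metric.isOpen_ball.measurableSet).1
  · refine ae_of_all _ fun y => ?_
    apply LipschitzOnWith.of_dist_le_mul
    intro a ha b hb
    have ha' : r / 2 < a := by
      have := abs_lt.1 (Metric.mem_ball.1 ha); linarith [this.1]
    have hb' : r / 2 < b := by
      have := abs_lt.1 (Metric.mem_ball.1 hb); linarith [this.1]
    have hA : r / 2 < max a ‖y‖ := lt_max_of_lt_left ha'
    have hB : r / 2 < max b ‖y‖ := lt_max_of_lt_left hb'
    have hA0 : 0 < max a ‖y‖ := by linarith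
    have hB0 : 0 < max b ‖y‖ := by linarith
    have hd : |max b ‖y‖ - max a ‖y‖| ≤ |a - b| := by
      rw [abs_sub_comm a b]
      exact abs_max_sub_max_le_abs _ _ _
    rw [Real.dist_eq, Real.dist_eq]
    simp only [Real.coe_nnabs]
    rw [show ρ y / (4 * π * max a ‖y‖) - ρ y / (4 * π * max b ‖y‖) =
      ρ y * ((max b ‖y‖ - max a ‖y‖) / (4 * π * (max a ‖y‖ * max b ‖y‖))) by field_simp]
    rw [abs_mul, abs_mul, abs_abs, mul_assoc |ρ y|, abs_div]
    rw [abs_of_pos (by positivity : 0 < 4 * π * (max a ‖y‖ * max b ‖y‖)),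
      abs_of_pos (by positivity : 0 < 1 / (π * r ^ 2))]
    apply mul_le_mul_of_nonneg_left _ (abs_nonneg _)
    rw [div_mul_eq_mul_div, one_mul]
    apply div_le_div₀ (abs_nonneg _) hd (by positivity)
    have : r / 2 * (r / 2) ≤ max a ‖y‖ * max b ‖y‖ := by gcongr
    nlinarith
  · exact hρ.abs.mul_const _
  · filter_upwards [ae_norm_ne r] with y hy
    rcases lt_or_gt_of_ne hy with h | h
    · rw [indicator_of_mem (by simpa using h)]
      have h1 : HasDerivAt (fun x : ℝ => ρ y / (4 * π * x)) (-ρ y / (4 * π * r ^ 2)) r := by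
        have := (hasDerivAt_inv hr.ne').const_mul (ρ y / (4 * π))
        refine (this.congr_deriv ?_).congr_of_eventuallyEq ?_
        · field_simp
        · refine Eventually.of_forall fun x => ?_
          simp only [div_eq_mul_inv, mul_inv, mul_assoc]
      refine h1.congr_of_eventuallyEq ?_
      filter_upwards [lt_mem_nhds h] with x hx
      rw [max_eq_left hx.le]
    · rw [indicator_of_notMem (by simpa using h.le)]
      refine (hasDerivAt_const r (ρ y / (4 * π * ‖y‖))).congr_of_eventuallyEq ?_
      filter_upwards [gt_mem_nhds h] with x hx
      rw [max_eq_right hx.le]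

lemma ballmass_cont (ρ : E3 → ℝ) (hρ : Integrable ρ) :
    Continuous (fun r => ∫ y in Metric.ball (0:E3) r, ρ y) := by
  simp only [← integral_indicator (Metric.isOpen_ball.measurableSet)]
  rw [continuous_iff_continuousAt]
  intro r
  refine continuousAt_of_dominated (bound := fun y => ‖ρ y‖) (Eventually.of_forall fun x =>
    (hρ.indicator Metric.isOpen_ball.measurableSet).1) (Eventually.of_forall fun x =>
    ae_of_all _ fun y => norm_indicator_le_norm_self _ _) hρ.norm ?_
  filter_upwards [ae_norm_ne r] with y hy
  rcases lt_or_gt_of_ne hy with h | h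
  · refine (continuousAt_const (y := ρ y)).congr ?_
    filter_upwards [lt_mem_nhds h] with x hx
    rw [indicator_of_mem (by simpa using hx)]
  · refine (continuousAt_const (y := (0:ℝ))).congr ?_
    filter_upwards [gt_mem_nhds h] with x hx
    rw [indicator_of_notMem (by simpa using hx.le)]

lemma ballmass_tendsto (ρ : E3 → ℝ) (hρ : Integrable ρ) :
    Tendsto (fun r => ∫ y in Metric.ball (0:E3) r, ρ y) atTop (𝓝 (∫ y, ρ y)) := by
  simp only [← integral_indicator (Metric.isOpen_ball.measurableSet)]
  refine tendsto_integral_filter_of_dominated_convergence (fun y => ‖ρ y‖) (Eventually.of_forall fun x =>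
    (hρ.indicator Metric.isOpen_ball.measurableSet).1) (Eventually.of_forall fun x =>
    ae_of_all _ fun y => norm_indicator_le_norm_self _ _) hρ.norm ?_
  refine ae_of_all _ fun y => ?_
  refine tendsto_const_nhds.congr' ?_
  filter_upwards [eventually_gt_atTop ‖y‖] with x hx
  rw [indicator_of_mem (by simpa using hx)]

/-- Level sets of the effective potential: regularity and bounds for `r₁, r₂`. -/
theorem stmt5 (f : Phase → ℝ) (hf : memErad f)
    (hf0 : ¬ f =ᵐ[volume] (0 : Phase → ℝ)) (ℓ : ℝ) (hℓ : 0 < ℓ) :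
    ContDiffOn ℝ 1 (fun e => r1Pot (phiRad f) e ℓ) (Ioo (eMinPot (phiRad f) ℓ) 0) ∧
    ContDiffOn ℝ 1 (fun e => r2Pot (phiRad f) e ℓ) (Ioo (eMinPot (phiRad f) ℓ) 0) ∧
    ∀ e ∈ Ioo (eMinPot (phiRad f) ℓ) 0,
      0 < ℓ / (2 * mass f) ∧
      ℓ / (2 * mass f) ≤ r1Pot (phiRad f) e ℓ ∧
      r1Pot (phiRad f) e ℓ < r2Pot (phiRad f) e ℓ ∧
      r2Pot (phiRad f) e ℓ ≤ mass f / |e| := by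
  obtain ⟨⟨hfm, hfn, hfE⟩, hsym⟩ := hf
  have hint : Integrable f := by
    rw [← memLp_one_iff_integrable]
    refine ⟨hfm.aestronglyMeasurable, lt_of_le_of_lt ?_ hfE⟩
    unfold eNormE
    rw [add_assoc]; exact le_self_add
  have hint' : Integrable f ((volume : Measure E3).prod (volume : Measure E3)) := hint
  set ρ := rhoF f with hρdef
  have hρint : Integrable ρ := hint'.integral_prod_left
  have hρm : Measurable ρ :=
    (hfm.stronglyMeasurable.integral_prod_right' (ν := (volume : Measure E3))).measurable
  have hρ0 : ∀ y, 0 ≤ ρ y := fun y => integral_nonneg fun v => hfn _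
  have hM : mass f = ∫ y, ρ y := integral_prod f hint'
  have hMpos : 0 < mass f := by
    refine lt_of_le_of_ne (integral_nonneg hfn) ?_
    intro hc
    exact hf0 ((integral_eq_zero_iff_of_nonneg hfn hint).1 hc.symm)
  have hpi := pi_pos
  have hpi3 := pi_gt_three
  set M := mass f
  set W : ℝ → ℝ := fun r => ∫ y : E3, ρ y / (4 * π * max r ‖y‖) with hW
  have hφ : ∀ r, 0 < r → phiRad f r = - W r := by
    intro r hr
    have hr2 := newton (fun s => ρ (s • (EuclideanSpace.single (0 : Fin 3) (1:ℝ)))) (by fun_prop)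
      (fun s => hρ0 _) r hr
    simp only [hρdef, ← rho_radial f hsym] at hr2
    simp only [phiRad, phiF, hW, hρdef]
    rw [hr2]
  have hWle : ∀ r, 0 < r → W r ≤ M / (4 * π * r) := by
    intro r hr
    rw [hM, ← integral_div]
    apply integral_mono_of_nonneg
    · exact ae_of_all _ fun y => div_nonneg (hρ0 y) (by positivity)
    · exact hρint.div_const _
    · refine ae_of_all _ fun y => ?_
      have := hρ0 y
      simp only
      gcongr
      exact le_max_left _ _
  set m : ℝ → ℝ := fun r => ∫ y in Metric.ball (0:E3) r, ρ y with hm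
  have hmc : Continuous m := ballmass_cont ρ hρint
  have hmt : Tendsto m atTop (𝓝 M) := hM ▸ ballmass_tendsto ρ hρint
  have hmm : Monotone m := by
    intro a b hab
    exact setIntegral_mono_set hρint.integrableOn (ae_of_all _ hρ0)
      (Metric.ball_subset_ball hab).eventuallyLE
  have hm0 : ∀ r, 0 ≤ m r := fun r => integral_nonneg hρ0
  obtain ⟨r0, hr0, hr0e⟩ : ∃ r0, 0 < r0 ∧ r0 * m r0 = 4 * π * ℓ := by
    have ht : Tendsto (fun r => r * m r) atTop atTop := tendsto_id.atTop_mul_pos hMpos hmt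
    obtain ⟨b, hb, hb0⟩ := ((ht.eventually_ge_atTop (4 * π * ℓ)).and (eventually_gt_atTop 0)).exists
    have := intermediate_value_Icc (f := fun r => r * m r) hb0.le (by fun_prop)
    obtain ⟨c, hc, hce⟩ := this (show 4 * π * ℓ ∈ _ from ⟨by simp only [zero_mul]; positivity, hb⟩)
    refine ⟨c, lt_of_le_of_ne hc.1 ?_, hce⟩
    rintro rfl
    simp only [zero_mul] at hce
    have : 0 < 4 * π * ℓ := by positivity
    linarith
  have hm0pos : 0 < m r0 := by
    have : 0 < r0 * m r0 := by rw [hr0e]; positivity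
    exact pos_of_mul_pos_right this hr0.le
  have hψW : ∀ r, 0 < r → psiPot (phiRad f) ℓ r = - W r + ℓ / (2 * r ^ 2) := by
    intro r hr; simp only [psiPot, hφ r hr]
  have hhe : ∀ r, 0 < r → m r / (4 * π * r ^ 2) - ℓ / r ^ 3 = (r * m r - r0 * m r0) / (4 * π * r ^ 3) := by
    intro r hr
    rw [hr0e]; field_simp
  have hlow : ∀ r, 0 < r → psiPot (phiRad f) ℓ r < 0 → ℓ / (2 * M) ≤ r := by
    intro r hr h
    rw [hψW r hr] at h
    have h1 := hWle r hr
    have h2 : ℓ / (2 * r ^ 2) < M / (4 * π * r) := by linarith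
    rw [div_lt_div_iff₀ (by positivity) (by positivity)] at h2
    have h3 : ℓ * (4 * π) < M * (2 * r) := by
      have : (ℓ * (4 * π)) * r < (M * (2 * r)) * r := by linarith
      exact lt_of_mul_lt_mul_right this hr.le
    rw [div_le_iff₀ (by positivity)]
    nlinarith
  have hup : ∀ r e, 0 < r → e < 0 → psiPot (phiRad f) ℓ r < e → r ≤ M / |e| := by
    intro r e hr he h
    rw [hψW r hr] at h
    have h1 := hWle r hr
    have h2 : 0 < ℓ / (2 * r ^ 2) := by positivity
    have h3 : -e < M / (4 * π * r) := by linarith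
    rw [lt_div_iff₀ (by positivity)] at h3
    rw [abs_of_neg he, le_div_iff₀ (by linarith)]
    have : 0 < -e * r := mul_pos (by linarith) hr
    nlinarith
  have H := abstract_part (phiRad f) (fun r => m r / (4 * π * r ^ 2) - ℓ / r ^ 3) ℓ
    (ℓ / (2 * M)) M r0 (by positivity) hr0
  have fin : ∀ {A B : Prop} {C : ℝ → Prop}, (A ∧ B ∧ ∀ e ∈ Ioo (eMinPot (phiRad f) ℓ) 0, C e) →
      (A ∧ B ∧ ∀ e ∈ Ioo (eMinPot (phiRad f) ℓ) 0, 0 < ℓ / (2 * M) ∧ C e) :=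
    fun H => ⟨H.1, H.2.1, fun e he => ⟨by positivity, H.2.2 e he⟩⟩
  refine fin (H ?_ ?_ ?_ ?_ hlow hup)
  · intro r hr
    have d1 := (pot_deriv ρ hρint r hr).neg
    have d2 : HasDerivAt (fun r : ℝ => ℓ / (2 * r ^ 2)) (-ℓ / r ^ 3) r := by
      have := (hasDerivAt_const r ℓ).div ((hasDerivAt_pow 2 r).const_mul 2) (by positivity)
      refine this.congr_deriv ?_
      field_simp
      norm_num
      ring
    refine ((d1.add d2).congr_deriv ?_).congr_of_eventuallyEq ?_
    · simp only [hm]; ring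
    · filter_upwards [lt_mem_nhds hr] with x hx
      rw [hψW x hx]; rfl
  · intro r hr
    have hr : 0 < r := hr
    apply ContinuousAt.continuousWithinAt
    apply ContinuousAt.sub
    · exact hmc.continuousAt.div (by fun_prop) (by positivity)
    · exact continuousAt_const.div (by fun_prop) (by positivity)
  · intro r hr hrr
    rw [hhe r hr]
    apply div_neg_of_neg_of_pos _ (by positivity)
    have := hmm hrr.le
    nlinarith [hm0 r]
  · intro r hrr
    have hr : 0 < r := hr0.trans hrr
    rw [hhe r hr]
    apply div_pos _ (by positivity)
    have := hmm hrr.le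
    nlinarith [hm0 r]
end
end

section
/- Let f ∈ E_rad be nonzero and φ = φ_f. For every ℓ > 0, every e ∈ (e_{φ,ℓ}, 0) and every r ∈ [r₁(φ,e,ℓ), r₂(φ,e,ℓ)], one has the concavity lower bound e − ψ_{φ,ℓ}(r) ≥ (ℓ/(2 r² r₁(φ,e,ℓ) r₂(φ,e,ℓ))) · (r − r₁(φ,e,ℓ)) · (r₂(φ,e,ℓ) − r). -/
noncomputable section

open MeasureTheory Real Filter Set Topology
open scoped ENNReal NNReal

lemma aux_split (F : ℝ → ℝ → ℝ≥0∞) (hF : Measurable (Function.uncurry F)) :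
    ∫⁻ y : E3, F ‖y‖ (y 0) =
      ∫⁻ z : ℝ, ∫⁻ p : ℝ × ℝ, F (√(z ^ 2 + (p.1 ^ 2 + p.2 ^ 2))) z := by
  have h1 := (PiLp.volume_preserving_toLp (Fin 3)).lintegral_comp_emb
    (MeasurableEquiv.toLp 2 (Fin 3 → ℝ)).measurableEmbedding (fun y : E3 => F ‖y‖ (y 0))
  have h2 := (volume_preserving_piFinSuccAbove (fun _ : Fin 3 => ℝ) 0).symm.lintegral_comp_emb
    (MeasurableEquiv.piFinSuccAbove (fun _ : Fin 3 => ℝ) 0).symm.measurableEmbedding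
    (fun y : Fin 3 → ℝ => F ‖WithLp.toLp 2 y‖ (y 0))
  have h3 := fun z : ℝ => (volume_preserving_finTwoArrow ℝ).symm.lintegral_comp_emb
    (MeasurableEquiv.finTwoArrow).symm.measurableEmbedding
    (fun y : Fin 2 → ℝ => F (√(z ^ 2 + (y 0 ^ 2 + y 1 ^ 2))) z)
  rw [← h1]
  simp only
  rw [← h2]
  have hm : Measurable (fun a : ℝ × (Fin 2 → ℝ) => F (√(a.1 ^ 2 + (a.2 0 ^ 2 + a.2 1 ^ 2))) a.1) := by
    have : Measurable (fun a : ℝ × (Fin 2 → ℝ) => (√(a.1 ^ 2 + (a.2 0 ^ 2 + a.2 1 ^ 2)), a.1)) := by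
      fun_prop
    exact hF.comp this
  calc _ = ∫⁻ a : ℝ × (Fin 2 → ℝ), F (√(a.1 ^ 2 + (a.2 0 ^ 2 + a.2 1 ^ 2))) a.1 := by
        refine lintegral_congr fun a => ?_
        have e0 : (MeasurableEquiv.piFinSuccAbove (fun _ : Fin 3 => ℝ) 0).symm a 0 = a.1 := by
          simp [MeasurableEquiv.piFinSuccAbove]
        have e1 : (MeasurableEquiv.piFinSuccAbove (fun _ : Fin 3 => ℝ) 0).symm a 1 = a.2 0 := rfl
        have e2 : (MeasurableEquiv.piFinSuccAbove (fun _ : Fin 3 => ℝ) 0).symm a 2 = a.2 1 := rfl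
        rw [EuclideanSpace.norm_eq, Fin.sum_univ_three]
        simp only [e0, e1, e2, Real.norm_eq_abs, sq_abs, add_assoc]
    _ = ∫⁻ z : ℝ, ∫⁻ y : Fin 2 → ℝ, F (√(z ^ 2 + (y 0 ^ 2 + y 1 ^ 2))) z := by
        rw [Measure.volume_eq_prod, lintegral_prod _ hm.aemeasurable]
    _ = _ := by
        refine lintegral_congr fun z => ?_
        rw [← h3 z]
        rfl

lemma aux_polar (H : ℝ → ℝ≥0∞) (hH : Measurable H) (z : ℝ) :
    ∫⁻ p : ℝ × ℝ, H (√(z ^ 2 + (p.1 ^ 2 + p.2 ^ 2))) =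
      ENNReal.ofReal (2 * π) * ∫⁻ t in Ioi (0:ℝ), ENNReal.ofReal t * H (√(z ^ 2 + t ^ 2)) := by
  rw [← lintegral_comp_polarCoord_symm]
  have : ∀ p : ℝ × ℝ, (polarCoord.symm p).1 ^ 2 + (polarCoord.symm p).2 ^ 2 = p.1 ^ 2 := by
    intro p
    simp only [polarCoord_symm_apply]
    linear_combination p.1 ^ 2 * Real.cos_sq_add_sin_sq p.2
  simp only [this, smul_eq_mul, polarCoord_target]
  rw [Measure.volume_eq_prod, ← Measure.prod_restrict, lintegral_prod _ (by fun_prop)]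
  simp only [lintegral_const, Measure.restrict_apply MeasurableSet.univ, univ_inter,
    Real.volume_Ioo]
  rw [lintegral_mul_const _ (by fun_prop), mul_comm]
  congr 2; ring

lemma aux_sub (H : ℝ → ℝ≥0∞) (z : ℝ) :
    ∫⁻ t in Ioi (0:ℝ), ENNReal.ofReal t * H (√(z ^ 2 + t ^ 2)) =
      ∫⁻ s in Ioi |z|, ENNReal.ofReal s * H s := by
  have key : ∀ s ∈ Ioi |z|, 0 < s ∧ 0 < s ^ 2 - z ^ 2 := by
    intro s hs
    have hs' : |z| < s := hs
    have h0 : 0 < s := (abs_nonneg z).trans_lt hs'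
    refine ⟨h0, ?_⟩
    have := sq_lt_sq' (by linarith [abs_nonneg z]) hs'
    rw [sq_abs] at this
    linarith
  have himg : (fun s => √(s ^ 2 - z ^ 2)) '' Ioi |z| = Ioi 0 := by
    ext t
    constructor
    · rintro ⟨s, hs, rfl⟩
      exact Real.sqrt_pos.2 (key s hs).2
    · intro ht
      have ht' : 0 < t := ht
      refine ⟨√(z ^ 2 + t ^ 2), ?_, ?_⟩
      · rw [mem_Ioi, ← Real.sqrt_sq_eq_abs]
        exact Real.sqrt_lt_sqrt (sq_nonneg _) (by nlinarith)
      · simp only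
        rw [Real.sq_sqrt (by positivity), add_sub_cancel_left, Real.sqrt_sq ht'.le]
  rw [← himg, lintegral_image_eq_lintegral_abs_deriv_mul (f' := fun s => s / √(s ^ 2 - z ^ 2))
    measurableSet_Ioi]
  · refine setLIntegral_congr_fun measurableSet_Ioi fun s hs => ?_
    obtain ⟨h0, h1⟩ := key s hs
    have h2 := Real.sqrt_pos.2 h1
    rw [Real.sq_sqrt h1.le, add_sub_cancel, Real.sqrt_sq h0.le, abs_of_pos (by positivity),
      ← mul_assoc, ← ENNReal.ofReal_mul (by positivity), div_mul_cancel₀ _ h2.ne']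
  · intro s hs
    obtain ⟨h0, h1⟩ := key s hs
    have := (((hasDerivAt_id s).pow 2).sub_const (z ^ 2)).sqrt h1.ne'
    refine (this.congr_deriv ?_).hasDerivWithinAt
    simp
    field_simp
  · intro a ha b hb hab
    obtain ⟨h0, h1⟩ := key a ha
    obtain ⟨h0', h1'⟩ := key b hb
    simp only at hab
    rw [Real.sqrt_inj h1.le h1'.le] at hab
    nlinarith

lemma aux_cyl (F : ℝ → ℝ → ℝ≥0∞) (hF : Measurable (Function.uncurry F)) :
    ∫⁻ y : E3, F ‖y‖ (y 0) =
      ENNReal.ofReal (2 * π) *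
        ∫⁻ s in Ioi (0:ℝ), ENNReal.ofReal s * ∫⁻ z in Ioo (-s) s, F s z := by
  rw [aux_split F hF]
  have hFz : ∀ z, Measurable fun s => F s z := fun z => hF.comp (by fun_prop : Measurable fun s : ℝ => (s, z))
  have hFs : ∀ s, Measurable fun z => F s z := fun s => hF.comp (by fun_prop : Measurable fun z : ℝ => (s, z))
  have hset : MeasurableSet {p : ℝ × ℝ | |p.1| < p.2} :=
    measurableSet_lt (by fun_prop) (by fun_prop)
  have hm : Measurable (Function.uncurry fun z s : ℝ =>
      {p : ℝ × ℝ | |p.1| < p.2}.indicator (fun p => ENNReal.ofReal p.2 * F p.2 p.1) (z, s)) := by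
    have : Measurable fun p : ℝ × ℝ => F p.2 p.1 :=
      hF.comp (by fun_prop : Measurable fun p : ℝ × ℝ => (p.2, p.1))
    exact Measurable.indicator (by fun_prop) hset
  calc _ = ∫⁻ z : ℝ, ENNReal.ofReal (2 * π) * ∫⁻ s in Ioi |z|, ENNReal.ofReal s * F s z := by
        refine lintegral_congr fun z => ?_
        rw [aux_polar (fun s => F s z) (hFz z) z, aux_sub (fun s => F s z)]
    _ = ∫⁻ z : ℝ, ENNReal.ofReal (2 * π) * ∫⁻ s : ℝ,
          {p : ℝ × ℝ | |p.1| < p.2}.indicator (fun p => ENNReal.ofReal p.2 * F p.2 p.1) (z, s) := by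
        refine lintegral_congr fun z => ?_
        rw [← lintegral_indicator measurableSet_Ioi]
        rfl
    _ = ENNReal.ofReal (2 * π) * ∫⁻ z : ℝ, ∫⁻ s : ℝ,
          {p : ℝ × ℝ | |p.1| < p.2}.indicator (fun p => ENNReal.ofReal p.2 * F p.2 p.1) (z, s) :=
        lintegral_const_mul' _ _ ENNReal.ofReal_ne_top
    _ = ENNReal.ofReal (2 * π) * ∫⁻ s : ℝ, ∫⁻ z : ℝ,
          {p : ℝ × ℝ | |p.1| < p.2}.indicator (fun p => ENNReal.ofReal p.2 * F p.2 p.1) (z, s) := by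
        rw [lintegral_lintegral_swap hm.aemeasurable]
    _ = _ := by
        congr 1
        rw [← lintegral_indicator measurableSet_Ioi]
        refine lintegral_congr fun s => ?_
        by_cases hs : 0 < s
        · rw [indicator_of_mem (by exact hs), ← lintegral_const_mul _ (hFs s),
            ← lintegral_indicator measurableSet_Ioo]
          refine lintegral_congr fun z => ?_
          simp only [indicator, mem_ofPred_eq, abs_lt, mem_Ioo]
        · rw [indicator_of_notMem (by exact hs)]
          have : ∀ z : ℝ, ¬ |z| < s := fun z hz => hs ((abs_nonneg z).trans_lt hz)
          simp [indicator, this]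

lemma aux_inner (r s : ℝ) (hr : 0 < r) (hs : 0 < s) :
    ∫⁻ z in Ioo (-s) s, ENNReal.ofReal (1 / √(r ^ 2 + s ^ 2 - 2 * r * z)) =
      ∫⁻ _z in Ioo (-s) s, ENNReal.ofReal (1 / max r s) := by
  have hpos : ∀ z ∈ Ioo (-s) s, 0 < r ^ 2 + s ^ 2 - 2 * r * z := by
    intro z hz
    nlinarith [sq_nonneg (r - s), hz.2, mul_pos hr (sub_pos.2 hz.2)]
  have hcont : ContinuousOn (fun z => -(√(r ^ 2 + s ^ 2 - 2 * r * z) / r)) (Icc (-s) s) := by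
    fun_prop
  have hder : ∀ z ∈ Ioo (-s) s, HasDerivAt (fun z => -(√(r ^ 2 + s ^ 2 - 2 * r * z) / r))
      (1 / √(r ^ 2 + s ^ 2 - 2 * r * z)) z := by
    intro z hz
    have h2 := Real.sqrt_pos.2 (hpos z hz)
    have := (((((hasDerivAt_id z).const_mul (2 * r)).const_sub (r ^ 2 + s ^ 2)).sqrt
      (hpos z hz).ne').div_const r).neg
    refine this.congr_deriv ?_
    simp
    field_simp
  have hnn : ∀ z, 0 ≤ 1 / √(r ^ 2 + s ^ 2 - 2 * r * z) := fun z => by positivity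
  have hint := intervalIntegral.integrableOn_deriv_of_nonneg hcont hder (fun z _ => hnn z)
  have hle : -s ≤ s := by linarith
  have hI := intervalIntegral.integral_eq_sub_of_hasDerivAt_of_le hle hcont hder
    ((intervalIntegrable_iff_integrableOn_Ioc_of_le hle).2 hint)
  rw [intervalIntegral.integral_of_le hle] at hI
  rw [setLIntegral_congr Ioo_ae_eq_Ioc, ← ofReal_integral_eq_lintegral_ofReal hint
    (Eventually.of_forall hnn), hI]
  simp only [lintegral_const, Measure.restrict_apply MeasurableSet.univ, univ_inter,
    Real.volume_Ioo]
  rw [← ENNReal.ofReal_mul (by positivity)]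
  congr 1
  have e1 : r ^ 2 + s ^ 2 - 2 * r * s = (r - s) ^ 2 := by ring
  have e2 : r ^ 2 + s ^ 2 - 2 * r * -s = (r + s) ^ 2 := by ring
  rw [e1, e2, Real.sqrt_sq_eq_abs, Real.sqrt_sq (by positivity)]
  rcases le_total r s with h | h
  · rw [max_eq_right h, abs_of_nonpos (by linarith)]; field_simp; ring
  · rw [max_eq_left h, abs_of_nonneg (by linarith)]; field_simp; ring

lemma aux_rot (x y : E3) (h : ‖x‖ = ‖y‖) :
    ∃ R : E3 ≃ₗᵢ[ℝ] E3, LinearMap.det (R.toLinearEquiv : E3 →ₗ[ℝ] E3) = 1 ∧ R x = y := by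
  have hfact : Fact (Module.finrank ℝ E3 = 2 + 1) := ⟨by simp⟩
  have hdet : ∀ v : E3, v ≠ 0 →
      LinearMap.det (((ℝ ∙ v).reflection).toLinearEquiv : E3 →ₗ[ℝ] E3) = 1 := by
    intro v hv
    have := (ℝ ∙ v).det_reflection
    rw [Submodule.finrank_orthogonal_span_singleton (n := 2) hv] at this
    simpa using this
  by_cases hxy : x + y = 0
  · obtain ⟨v, hv, hv0⟩ : ∃ v : E3, v ≠ 0 ∧ inner ℝ x v = 0 := by
      by_cases hx : x = 0
      · exact ⟨EuclideanSpace.single 0 1, by simp, by simp [hx]⟩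
      · have hr := Submodule.finrank_orthogonal_span_singleton (𝕜 := ℝ) (n := 2) hx
        have : (ℝ ∙ x)ᗮ ≠ ⊥ := by
          intro hb
          rw [hb] at hr
          simp at hr
        obtain ⟨v, hv, hv0⟩ := (Submodule.ne_bot_iff _).1 this
        exact ⟨v, hv0, Submodule.mem_orthogonal_singleton_iff_inner_right.1 hv⟩
    refine ⟨(ℝ ∙ v).reflection, hdet v hv, ?_⟩
    rw [Submodule.reflection_mem_subspace_orthogonalComplement_eq_neg]
    · exact (eq_neg_of_add_eq_zero_right hxy).symm
    · exact Submodule.mem_orthogonal_singleton_iff_inner_left.2 hv0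
  · refine ⟨(ℝ ∙ (x + y)).reflection, hdet _ hxy, ?_⟩
    have hdiff : x - y ∈ (ℝ ∙ (x + y))ᗮ := by
      rw [Submodule.mem_orthogonal_singleton_iff_inner_right]
      simp only [inner_add_left, inner_sub_right, real_inner_self_eq_norm_sq, h,
        real_inner_comm x y]
      ring
    have h1 : (ℝ ∙ (x + y)).reflection (x + y) = x + y :=
      Submodule.reflection_mem_subspace_eq_self (Submodule.mem_span_singleton_self _)
    have h2 := Submodule.reflection_mem_subspace_orthogonalComplement_eq_neg hdiff
    have h3 : x = (2:ℝ)⁻¹ • ((x + y) + (x - y)) := by module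
    have h4 : (ℝ ∙ (x + y)).reflection x =
        (ℝ ∙ (x + y)).reflection ((2:ℝ)⁻¹ • ((x + y) + (x - y))) := congrArg _ h3
    rw [h4, map_smul, map_add, h1, h2]
    module

abbrev e0v : E3 := EuclideanSpace.single (0 : Fin 3) (1:ℝ)

lemma aux_norm (r : ℝ) (y : E3) : ‖r • e0v - y‖ = √(r ^ 2 + ‖y‖ ^ 2 - 2 * r * y 0) := by
  rw [EuclideanSpace.norm_eq, EuclideanSpace.norm_sq_eq, Fin.sum_univ_three, Fin.sum_univ_three]
  congr 1
  simp [e0v]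
  ring

lemma aux_newton (ρ : E3 → ℝ) (hm : Measurable ρ) (h0 : ∀ y, 0 ≤ ρ y)
    (hrad : ∀ y, ρ y = ρ (‖y‖ • e0v)) (r : ℝ) (hr : 0 < r) :
    ∫ y : E3, ρ y / (4 * π * ‖r • e0v - y‖) = ∫ y : E3, ρ y / (4 * π * max r ‖y‖) := by
  have hG : Measurable fun s : ℝ => ENNReal.ofReal (ρ (s • e0v) / (4 * π)) := by
    have : Measurable fun s : ℝ => ρ (s • e0v) := hm.comp (by fun_prop)
    fun_prop
  rw [integral_eq_lintegral_of_nonneg_ae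
      (Eventually.of_forall fun y => div_nonneg (h0 y) (by positivity))
      (Measurable.aestronglyMeasurable (by fun_prop)),
    integral_eq_lintegral_of_nonneg_ae
      (Eventually.of_forall fun y => div_nonneg (h0 y) (by positivity))
      (Measurable.aestronglyMeasurable (by fun_prop))]
  congr 1
  have e1 : ∀ y : E3, ENNReal.ofReal (ρ y / (4 * π * ‖r • e0v - y‖)) =
      (fun s z : ℝ => ENNReal.ofReal (ρ (s • e0v) / (4 * π)) *
        ENNReal.ofReal (1 / √(r ^ 2 + s ^ 2 - 2 * r * z))) ‖y‖ (y 0) := by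
    intro y
    simp only
    rw [← hrad, ← aux_norm, ← ENNReal.ofReal_mul (div_nonneg (h0 y) (by positivity)),
      div_mul_div_comm, mul_one]
  have e2 : ∀ y : E3, ENNReal.ofReal (ρ y / (4 * π * max r ‖y‖)) =
      (fun s _z : ℝ => ENNReal.ofReal (ρ (s • e0v) / (4 * π)) *
        ENNReal.ofReal (1 / max r s)) ‖y‖ (y 0) := by
    intro y
    simp only
    rw [← hrad, ← ENNReal.ofReal_mul (div_nonneg (h0 y) (by positivity)),
      div_mul_div_comm, mul_one]
  have hG1 : Measurable fun p : ℝ × ℝ => ENNReal.ofReal (ρ (p.1 • e0v) / (4 * π)) :=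
    hG.comp measurable_fst
  simp_rw [e1, e2]
  rw [aux_cyl (fun s z : ℝ => ENNReal.ofReal (ρ (s • e0v) / (4 * π)) *
        ENNReal.ofReal (1 / √(r ^ 2 + s ^ 2 - 2 * r * z)))
      (by unfold Function.uncurry; exact hG1.mul (by fun_prop)),
    aux_cyl (fun s _z : ℝ => ENNReal.ofReal (ρ (s • e0v) / (4 * π)) *
        ENNReal.ofReal (1 / max r s))
      (by unfold Function.uncurry; exact hG1.mul (by fun_prop))]
  congr 1
  refine setLIntegral_congr_fun measurableSet_Ioi fun s hs => ?_
  rw [lintegral_const_mul' _ _ ENNReal.ofReal_ne_top, lintegral_const_mul' _ _ ENNReal.ofReal_ne_top,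
    aux_inner r s hr hs]

lemma aux_k (a b r₁ r₂ s : ℝ) (ha : 0 ≤ a) (hb : 0 ≤ b) (hab : a + b = 1) (h1 : 0 < r₁)
    (h2 : 0 < r₂) : a * (r₁ / max r₁ s) + b * (r₂ / max r₂ s) ≤
      (a * r₁ + b * r₂) / max (a * r₁ + b * r₂) s := by
  have hm : 0 < a * r₁ + b * r₂ := by
    rcases ha.lt_or_eq with h | h
    · positivity
    · subst h
      have : b = 1 := by linarith
      subst this; simpa using h2
  have k1 : ∀ r, 0 < r → r / max r s ≤ 1 := fun r hr =>
    (div_le_one (lt_max_of_lt_left hr)).2 (le_max_left _ _)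
  rcases le_total s (a * r₁ + b * r₂) with h | h
  · rw [max_eq_left h, div_self hm.ne']
    nlinarith [k1 r₁ h1, k1 r₂ h2]
  · have hs : 0 < s := hm.trans_le h
    have k2 : ∀ r, 0 < r → r / max r s ≤ r / s := fun r hr =>
      div_le_div_of_nonneg_left hr.le hs (le_max_right _ _)
    rw [max_eq_right h, add_div, mul_div_assoc, mul_div_assoc]
    exact add_le_add (mul_le_mul_of_nonneg_left (k2 _ h1) ha)
      (mul_le_mul_of_nonneg_left (k2 _ h2) hb)

lemma aux_rho (f : Phase → ℝ) (hf : memErad f) :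
    Measurable (rhoF f) ∧ (∀ y, 0 ≤ rhoF f y) ∧ (∀ y, rhoF f y = rhoF f (‖y‖ • e0v)) ∧
      Integrable (rhoF f) := by
  obtain ⟨⟨hm, h0, hE⟩, hs⟩ := hf
  refine ⟨?_, fun y => integral_nonneg fun v => h0 _, ?_, ?_⟩
  · exact (hm.stronglyMeasurable.integral_prod_right').measurable
  · intro y
    obtain ⟨R, hR, hRy⟩ := aux_rot (‖y‖ • e0v) y (by simp [norm_smul])
    unfold rhoF
    rw [← R.measurePreserving.integral_comp R.toMeasurableEquiv.measurableEmbedding]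
    refine integral_congr_ae (Eventually.of_forall fun v => ?_)
    have := hs R hR (‖y‖ • e0v, v)
    simp only [hRy] at this
    exact this
  · have hi : Integrable f := by
      rw [← memLp_one_iff_integrable]
      refine ⟨hm.aestronglyMeasurable, lt_of_le_of_lt ?_ hE⟩
      unfold eNormE
      rw [add_assoc]
      exact le_self_add
    rw [Measure.volume_eq_prod] at hi
    exact hi.integral_prod_left

lemma aux_phi (f : Phase → ℝ) (hf : memErad f) :
    ConvexOn ℝ (Ioi 0) (fun r => r * phiRad f r) ∧ ∃ C, ∀ r, 0 < r → -C ≤ r * phiRad f r := by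
  obtain ⟨hm, h0, hrad, hint⟩ := aux_rho f hf
  have hφ : ∀ r, 0 < r → r * phiRad f r = - ∫ y : E3, rhoF f y / (4 * π) * (r / max r ‖y‖) := by
    intro r hr
    unfold phiRad phiF
    rw [aux_newton _ hm h0 hrad r hr, mul_neg, ← integral_const_mul]
    congr 2
    ext y
    have : 0 < max r ‖y‖ := lt_max_of_lt_left hr
    field_simp
  have hk : ∀ r, 0 < r → ∀ y : E3, 0 ≤ r / max r ‖y‖ ∧ r / max r ‖y‖ ≤ 1 := fun r hr y =>
    ⟨by positivity, (div_le_one (lt_max_of_lt_left hr)).2 (le_max_left _ _)⟩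
  have hI : ∀ r, 0 < r → Integrable (fun y : E3 => rhoF f y / (4 * π) * (r / max r ‖y‖)) := by
    intro r hr
    refine (hint.div_const (4 * π)).mul_bdd (c := 1) (Measurable.aestronglyMeasurable (by fun_prop)) (Eventually.of_forall fun y => ?_)
    rw [Real.norm_of_nonneg (hk r hr y).1]
    exact (hk r hr y).2
  have hd : ∀ y, 0 ≤ rhoF f y / (4 * π) := fun y => div_nonneg (h0 y) (by positivity)
  refine ⟨⟨convex_Ioi 0, ?_⟩, ∫ y : E3, rhoF f y / (4 * π), ?_⟩
  · intro r₁ h1 r₂ h2 a b ha hb hab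
    have h3 : 0 < a • r₁ + b • r₂ := (convex_Ioi (0:ℝ)) h1 h2 ha hb hab
    simp only
    rw [hφ _ h1, hφ _ h2, hφ _ h3]
    simp only [smul_eq_mul, mul_neg]
    rw [← neg_add, neg_le_neg_iff, ← integral_const_mul, ← integral_const_mul,
      ← integral_add ((hI _ h1).const_mul a) ((hI _ h2).const_mul b)]
    refine integral_mono (((hI _ h1).const_mul a).add ((hI _ h2).const_mul b)) (hI _ h3) fun y => ?_
    have := mul_le_mul_of_nonneg_left (aux_k a b r₁ r₂ ‖y‖ ha hb hab h1 h2) (hd y)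
    simp only [smul_eq_mul]
    linarith
  · intro r hr
    rw [hφ r hr, neg_le_neg_iff]
    exact integral_mono (hI r hr) (hint.div_const _) fun y =>
      mul_le_of_le_one_right (hd y) (hk r hr y).2

lemma aux_final (φ : ℝ → ℝ) (hc : ConvexOn ℝ (Ioi 0) (fun r => r * φ r)) (C : ℝ)
    (hC : ∀ r, 0 < r → -C ≤ r * φ r) (ℓ : ℝ) (hℓ : 0 < ℓ) (e : ℝ)
    (he : e ∈ Ioo (eMinPot φ ℓ) 0) (r : ℝ) (hr : r ∈ Icc (r1Pot φ e ℓ) (r2Pot φ e ℓ)) :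
    ℓ / (2 * r ^ 2 * r1Pot φ e ℓ * r2Pot φ e ℓ) *
            ((r - r1Pot φ e ℓ) * (r2Pot φ e ℓ - r)) ≤ e - psiPot φ ℓ r := by
  set S : Set ℝ := {r : ℝ | 0 < r ∧ psiPot φ ℓ r < e} with hS
  have hne : S.Nonempty := by
    obtain ⟨_, ⟨x, hx, rfl⟩, hlt⟩ := exists_lt_of_csInf_lt (Nonempty.image _ nonempty_Ioi) he.1
    exact ⟨x, hx, hlt⟩
  have hlow : ∀ x ∈ S, ℓ / (2 * (|C| + 1)) ≤ x := by
    rintro x ⟨hx, hlt⟩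
    have h1 := hC x hx
    unfold psiPot at hlt
    have h2 : x * (φ x + ℓ / (2 * x ^ 2)) < 0 :=
      mul_neg_of_pos_of_neg hx (hlt.trans he.2)
    have h3 : x * (ℓ / (2 * x ^ 2)) = ℓ / (2 * x) := by field_simp
    rw [mul_add, h3] at h2
    have h4 : ℓ / (2 * x) < |C| + 1 := by linarith [le_abs_self C]
    rw [div_lt_iff₀ (by positivity)] at h4
    rw [div_le_iff₀ (by positivity)]
    linarith
  have hr1 : 0 < r1Pot φ e ℓ := lt_of_lt_of_le (by positivity) (le_csInf hne hlow)
  have hbdd : BddAbove S := by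
    by_contra hb
    have : r2Pot φ e ℓ = 0 := Real.sSup_of_not_bddAbove hb
    linarith [hr.1, hr.2]
  have m1 : r1Pot φ e ℓ ∈ closure S := csInf_mem_closure hne ⟨_, hlow⟩
  have m2 : r2Pot φ e ℓ ∈ closure S := csSup_mem_closure hne hbdd
  have hr2 : 0 < r2Pot φ e ℓ := by linarith [hr.1, hr.2]
  have hcont := hc.continuousOn isOpen_Ioi
  have hcl : ∀ x, 0 < x → x ∈ closure S → x * φ x ≤ e * x - ℓ / (2 * x) := by
    intro x hx hxS
    by_contra hcon
    push Not at hcon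
    have c1 : ContinuousAt (fun r => r * φ r) x := hcont.continuousAt (Ioi_mem_nhds hx)
    have c2 : ContinuousAt (fun r : ℝ => e * r - ℓ / (2 * r)) x := by
      have : 2 * x ≠ 0 := by positivity
      fun_prop (disch := assumption)
    have hev := c2.eventually_lt c1 hcon
    obtain ⟨y, ⟨hy, hlt⟩, hy2⟩ := ((mem_closure_iff_frequently.1 hxS).and_eventually hev).exists
    unfold psiPot at hlt
    have h2 := mul_lt_mul_of_pos_left hlt hy
    have h3 : y * (ℓ / (2 * y ^ 2)) = ℓ / (2 * y) := by field_simp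
    rw [mul_add, h3] at h2
    linarith
  have g1 := hcl _ hr1 m1
  have g2 := hcl _ hr2 m2
  generalize r1Pot φ e ℓ = r₁ at *
  generalize r2Pot φ e ℓ = r₂ at *
  have hr0 : 0 < r := by linarith [hr.1]
  rw [← segment_eq_Icc (hr.1.trans hr.2)] at hr
  obtain ⟨a, b, ha, hb, hab, hrr⟩ := hr
  have hconv := hc.2 hr1 hr2 ha hb hab
  simp only [hrr] at hconv
  simp only [smul_eq_mul] at hconv hrr
  have key : a * (ℓ / (2 * r₁)) + b * (ℓ / (2 * r₂)) - ℓ / (2 * r) ≤ r * (e - psiPot φ ℓ r) := by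
    unfold psiPot
    have h3 : r * (e - (φ r + ℓ / (2 * r ^ 2))) = e * r - r * φ r - ℓ / (2 * r) := by
      field_simp; ring
    rw [h3]
    have t1 := mul_le_mul_of_nonneg_left g1 ha
    have t2 := mul_le_mul_of_nonneg_left g2 hb
    have t3 : e * r = a * (e * r₁) + b * (e * r₂) := by rw [← hrr]; ring
    linarith
  have hid : a * (ℓ / (2 * r₁)) + b * (ℓ / (2 * r₂)) - ℓ / (2 * r) =
      r * (ℓ / (2 * r ^ 2 * r₁ * r₂) * ((r - r₁) * (r₂ - r))) := by
    have ha' : a = 1 - b := by linarith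
    subst ha'
    field_simp
    rw [← hrr]
    ring
  rw [hid] at key
  exact le_of_mul_le_mul_left key hr0

/-- Concavity lower bound for the effective potential. -/
theorem stmt6 (f : Phase → ℝ) (hf : memErad f)
    (hf0 : ¬ f =ᵐ[volume] (0 : Phase → ℝ)) :
    ∀ ℓ : ℝ, 0 < ℓ → ∀ e ∈ Ioo (eMinPot (phiRad f) ℓ) 0,
      ∀ r ∈ Icc (r1Pot (phiRad f) e ℓ) (r2Pot (phiRad f) e ℓ),
        ℓ / (2 * r ^ 2 * r1Pot (phiRad f) e ℓ * r2Pot (phiRad f) e ℓ) *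
            ((r - r1Pot (phiRad f) e ℓ) * (r2Pot (phiRad f) e ℓ - r))
          ≤ e - psiPot (phiRad f) ℓ r := by
  intro ℓ hℓ e he r hr
  obtain ⟨hc, C, hC⟩ := aux_phi f hf
  exact aux_final (phiRad f) hc C hC ℓ hℓ e he r hr
end
end
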